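/- Let (X, T) be a finite simplicial pair and K = X \ T with a discrete gradient V_K, extended to a gradient V_X on X making all simplices of T critical. Then for every i ≥ 0, the homology of the Morse complex M_•(K) of K is isomorphic to the relative simplicial homology H_i(X, T), i.e., to the Borel–Moore homology H_i^{BM}(K). -/

import Mathlib

open Finset
open scoped Classical

universe u

/-- A finite abstract simplicial complex on vertex type `V`. -/
structure SComplex (V : Type u) [DecidableEq V] where
  faces : Finset (Finset V)
  nonempty_of_mem : ∀ s ∈ faces, s.Nonempty
  down_closed : ∀ s ∈ faces, ∀ t, t ⊆ s → t.Nonempty → t ∈ faces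

variable {V : Type u} [DecidableEq V]

/-- `σ` is a codimension-1 face of `τ`. -/
def Face1 (σ τ : Finset V) : Prop := σ ⊆ τ ∧ σ.card + 1 = τ.card

/-- `f` is a discrete Morse function on the collection of simplices `S`. -/
def IsDMFOn (S : Set (Finset V)) (f : Finset V → ℝ) : Prop :=
  ∀ α ∈ S, {β | β ∈ S ∧ Face1 α β ∧ f β ≤ f α}.Subsingleton ∧
           {ν | ν ∈ S ∧ Face1 ν α ∧ f α ≤ f ν}.Subsingleton

/-- `σ` is a critical cell of the discrete Morse function `f` on `S`. -/
def IsCriticalIn (S : Set (Finset V)) (f : Finset V → ℝ) (σ : Finset V) : Prop :=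
  σ ∈ S ∧ (¬ ∃ β ∈ S, Face1 σ β ∧ f β ≤ f σ) ∧ (¬ ∃ ν ∈ S, Face1 ν σ ∧ f σ ≤ f ν)

/-- The discrete vector field associated to a discrete Morse function. -/
def gradSet (S : Set (Finset V)) (f : Finset V → ℝ) : Set (Finset V × Finset V) :=
  {p | p.1 ∈ S ∧ p.2 ∈ S ∧ Face1 p.1 p.2 ∧ f p.2 ≤ f p.1}

/-- `W` is a discrete vector field on the collection of simplices `S`:
pairs `(α, β)` with `α` a codimension-1 face of `β`, each simplex in at most one pair. -/
def IsVFOn (S : Set (Finset V)) (W : Set (Finset V × Finset V)) : Prop :=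
  (∀ p ∈ W, p.1 ∈ S ∧ p.2 ∈ S ∧ Face1 p.1 p.2) ∧
  (∀ p ∈ W, ∀ q ∈ W, p ≠ q → p.1 ≠ q.1 ∧ p.1 ≠ q.2 ∧ p.2 ≠ q.1 ∧ p.2 ≠ q.2)

/-- One step of a `V`-path: from the pair `(α, β)` one may pass to the pair `(α', β')`
provided `α'` is a codimension-1 face of `β` different from `α`. -/
def VStep (p q : Finset V × Finset V) : Prop := Face1 q.1 p.2 ∧ q.1 ≠ p.1

/-- A `V`-path, recorded as its list of matched pairs `(αᵢ, βᵢ)`. -/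
def IsVPath (W : Set (Finset V × Finset V)) (l : List (Finset V × Finset V)) : Prop :=
  (∀ p ∈ l, p ∈ W) ∧ l.Chain' VStep

/-- `W` admits a nontrivial closed `V`-path. -/
def HasClosedVPath (W : Set (Finset V × Finset V)) : Prop :=
  ∃ p l, IsVPath W (p :: l) ∧ VStep ((p :: l).getLast (List.cons_ne_nil p l)) p

/-- A discrete gradient: a discrete vector field with no nontrivial closed paths. -/
def IsGradientOn (S : Set (Finset V)) (W : Set (Finset V × Finset V)) : Prop :=
  IsVFOn S W ∧ ¬ HasClosedVPath W

/-- The critical cells of the vector field `W` among the simplices of `S`. -/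
def critOf (W : Set (Finset V × Finset V)) (S : Set (Finset V)) : Set (Finset V) :=
  {s | s ∈ S ∧ ∀ p ∈ W, p.1 ≠ s ∧ p.2 ≠ s}

/-- The chains (nonempty totally ordered collections) of simplices from `K`;
these are the simplices of the order complex `S_K`. -/
def chainsOf (K : Set (Finset V)) : Set (Finset (Finset V)) :=
  {C | C.Nonempty ∧ ↑C ⊆ K ∧ IsChain (· ⊆ ·) (C : Set (Finset V))}

/-- The open simplicial complex `K = X \ T`. -/
def Kset (X T : SComplex V) : Set (Finset V) :=
  (↑X.faces : Set (Finset V)) \ ↑T.faces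

/-- The level "subcomplex" determined by the value `a`:
all simplices contained in some simplex of `f`-value at most `a`. -/
def sublevel (S : Set (Finset V)) (f : Finset V → ℝ) (a : ℝ) : Set (Finset V) :=
  {τ | τ.Nonempty ∧ ∃ σ ∈ S, f σ ≤ a ∧ τ ⊆ σ}

/-- The geometric realization of a collection of (open) simplices on vertex set `V`,
as the set of convex weights whose support is a member of the collection. -/
noncomputable def realize [Fintype V] (L : Set (Finset V)) : Set (V → ℝ) :=
  {w | (∀ v, 0 ≤ w v) ∧ (∑ v, w v = 1) ∧ (Finset.univ.filter fun v => w v ≠ 0) ∈ L}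

/-- `A` is a strong deformation retract of `Y`. -/
def IsStrongDefRetract {Z : Type*} [TopologicalSpace Z] (Y A : Set Z) : Prop :=
  A ⊆ Y ∧ ∃ H : C(↥Y × ↥unitInterval, ↥Y),
    (∀ y, H (y, 0) = y) ∧ (∀ y, ((H (y, 1) : ↥Y) : Z) ∈ A) ∧
    ∀ y : ↥Y, (y : Z) ∈ A → ∀ t, H (y, t) = y

/-- An elementary collapse: remove a free pair `(σ, τ)`. -/
def ElemCollapse (Y Y' : Set (Finset V)) : Prop :=
  ∃ σ τ, σ ∈ Y ∧ τ ∈ Y ∧ Face1 σ τ ∧ (∀ ρ ∈ Y, σ ⊂ ρ → ρ = τ) ∧ Y' = Y \ {σ, τ}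

section Morse

variable [LinearOrder V] [Fintype V]

/-- The simplicial incidence sign of a codimension-1 face `σ` of `τ`. -/
noncomputable def incSign (σ τ : Finset V) : ℤ :=
  if Face1 σ τ then (-1 : ℤ) ^ (∑ v ∈ τ \ σ, (τ.filter fun x => x < v).card) else 0

/-- The first cell of a path, or `σ` if the path is empty. -/
def nextCell (σ : Finset V) : List (Finset V × Finset V) → Finset V
  | [] => σ
  | q :: _ => q.1

/-- The sign (Forman index factor) of a gradient path ending at `σ`. -/
noncomputable def pathSign (σ : Finset V) : List (Finset V × Finset V) → ℤ
  | [] => 1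
  | (a, b) :: rest => (-(incSign a b) * incSign (nextCell σ rest) b) * pathSign σ rest

/-- The gradient paths from (the boundary of) a critical cell `τ` to a critical cell `σ`. -/
def gradPaths (W : Set (Finset V × Finset V)) (τ σ : Finset V) :
    Set (List (Finset V × Finset V)) :=
  {l | IsVPath W l ∧ (∀ q ∈ l.head?, Face1 q.1 τ) ∧ (l = [] → Face1 σ τ) ∧
       (∀ q ∈ l.getLast?, Face1 σ q.2 ∧ σ ≠ q.1)}

/-- The coefficient of `σ` in the Morse boundary of `τ`:
the signed count of gradient paths from `τ` to `σ`. -/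
noncomputable def morseCoeff (W : Set (Finset V × Finset V)) (τ σ : Finset V) : ℤ :=
  ∑ᶠ l ∈ gradPaths W τ σ, incSign (nextCell σ l) τ * pathSign σ l

/-- The cells of `S` with `i` vertices (i.e. of dimension `i - 1`). -/
def cellsD (S : Set (Finset V)) (i : ℕ) : Type u := {s : Finset V // s ∈ S ∧ s.card = i}

noncomputable instance (S : Set (Finset V)) (i : ℕ) : Fintype (cellsD S i) := by
  unfold cellsD; infer_instance

/-- The Morse boundary operator from (geometric) degree `i` to degree `i - 1`,
on chains generated by the cells of `S`. -/
noncomputable def morseBd (W : Set (Finset V × Finset V)) (S : Set (Finset V)) (i : ℕ) :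
    (cellsD S (i + 1) → ℤ) →ₗ[ℤ] (cellsD S i → ℤ) :=
  Matrix.mulVecLin (Matrix.of fun (σ : cellsD S i) (τ : cellsD S (i + 1)) =>
    morseCoeff W τ.1 σ.1)

/-- The simplicial boundary operator on chains generated by the cells of `S`
(faces outside `S` are dropped; for `S = X \ T` this is the relative chain complex). -/
noncomputable def simpBd (S : Set (Finset V)) (i : ℕ) :
    (cellsD S (i + 1) → ℤ) →ₗ[ℤ] (cellsD S i → ℤ) :=
  Matrix.mulVecLin (Matrix.of fun (σ : cellsD S i) (τ : cellsD S (i + 1)) =>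
    incSign σ.1 τ.1)

end Morse

/-- Homology at a spot of a (would-be) chain complex: the kernel of `d1`
modulo (the pullback of) the image of `d2`. -/
abbrev Hgy {R A B C : Type*} [Ring R] [AddCommGroup A] [AddCommGroup B] [AddCommGroup C]
    [Module R A] [Module R B] [Module R C] (d1 : B →ₗ[R] A) (d2 : C →ₗ[R] B) : Type _ :=
  LinearMap.ker d1 ⧸ Submodule.comap (LinearMap.ker d1).subtype (LinearMap.range d2)

/-- The homology in geometric degree `i` of the Morse complex of the gradient `W`
with cells drawn from `S` (typically `S` = critical cells of `W`). -/
noncomputable abbrev MorseHomology [LinearOrder V] [Fintype V]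
    (W : Set (Finset V × Finset V)) (S : Set (Finset V)) (i : ℕ) : Type u :=
  Hgy (morseBd W S i) (morseBd W S (i + 1))

/-- The relative simplicial homology `H_i(X, T)` in geometric degree `i`, presented as the
homology of the chain complex generated by the cells of `K = X \ T`; for an open simplicial
complex `K` this is the Borel–Moore homology `H_i^{BM}(K)`. -/
noncomputable abbrev BMHomology [LinearOrder V] [Fintype V] (K : Set (Finset V)) (i : ℕ) :
    Type u :=
  Hgy (simpBd K i) (simpBd K (i + 1))

/-- A cell of the order complex is critical for the induced gradient `W` (the restriction of
the gradient `V'` on `sd X` to `S`) if it is `V'`-critical or its `V'`-partner lies outside `S`. -/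
def WCritOf (S : Set (Finset V)) (V' : Set (Finset V × Finset V)) (C : Finset V) : Prop :=
  C ∈ S ∧ ((∀ p ∈ V', p.1 ≠ C ∧ p.2 ≠ C) ∨
           (∃ p ∈ V', (p.1 = C ∧ p.2 ∉ S) ∨ (p.2 = C ∧ p.1 ∉ S)))

/-- `σ` has height `i` in `K`: the longest chain of simplices of `K` ending at `σ`
has `i + 1` elements. -/
def HasHeight (K : Set (Finset V)) (σ : Finset V) (i : ℕ) : Prop :=
  IsGreatest {n | ∃ l : List (Finset V), l.length = n ∧ l.Chain' (· ⊂ ·) ∧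
    (∀ s ∈ l, s ∈ K) ∧ l.getLast? = some σ} (i + 1)

section Incidence

variable [LinearOrder V]

lemma incSign_of_not_face1 {σ τ : Finset V} (h : ¬ Face1 σ τ) : incSign σ τ = 0 := if_neg h

lemma face1_of_incSign_ne_zero {σ τ : Finset V} (h : incSign σ τ ≠ 0) : Face1 σ τ :=
  not_imp_comm.1 incSign_of_not_face1 h

lemma incSign_mul_self {σ τ : Finset V} (h : Face1 σ τ) : incSign σ τ * incSign σ τ = 1 := by
  rw [incSign, if_pos h, ← pow_add, Even.neg_one_pow ⟨_, rfl⟩]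

lemma incSign_insert {σ : Finset V} {v : V} (hv : v ∉ σ) :
    incSign σ (insert v σ) = (-1) ^ (σ.filter fun x => x < v).card := by
  have hface : Face1 σ (insert v σ) := ⟨subset_insert _ _, (card_insert_of_notMem hv).symm⟩
  have hdiff : insert v σ \ σ = {v} := by
    ext x
    simp only [mem_sdiff, mem_insert, mem_singleton]
    constructor
    · tauto
    · rintro rfl
      exact ⟨Or.inl rfl, hv⟩
  rw [incSign, if_pos hface, hdiff, sum_singleton, filter_insert, if_neg (lt_irrefl v)]

lemma incSign_insert_insert_add {z : Finset V} {u v : V} (hu : u ∉ z) (hv : v ∉ z) (huv : u < v) :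
    incSign z (insert u z) * incSign (insert u z) (insert u (insert v z)) +
      incSign z (insert v z) * incSign (insert v z) (insert u (insert v z)) = 0 := by
  have hu' : u ∉ insert v z := by simp [huv.ne, hu]
  have hv' : v ∉ insert u z := by simp [huv.ne', hv]
  rw [incSign_insert hu, incSign_insert hv, incSign_insert hu', Finset.insert_comm u v,
    incSign_insert hv', filter_insert, filter_insert, if_pos huv, if_neg huv.not_gt,
    card_insert_of_notMem (by simp [hu])]
  ring

variable [Fintype V] in
/-- The simplicial boundary squares to zero. -/
lemma sum_incSign_mul_incSign (z b : Finset V) :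
    ∑ y, incSign z y * incSign y b = 0 := by
  by_cases h : z ⊆ b ∧ z.card + 2 = b.card
  · obtain ⟨hzb, hcard⟩ := h
    have h2 : (b \ z).card = 2 := by rw [card_sdiff_of_subset hzb]; omega
    obtain ⟨u, v, huv, hb⟩ : ∃ u v : V, u < v ∧ b \ z = {u, v} := by
      obtain ⟨u, v, hne, hb⟩ := card_eq_two.1 h2
      rcases hne.lt_or_gt with h | h
      · exact ⟨u, v, h, hb⟩
      · exact ⟨v, u, h, by rw [hb, pair_comm]⟩
    have hu : u ∈ b \ z := by simp [hb]
    have hv : v ∈ b \ z := by simp [hb]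
    rw [mem_sdiff] at hu hv
    have hbz : b = insert u (insert v z) := by
      rw [← sdiff_union_of_subset hzb, hb]
      ext x
      simp
    have hne : insert u z ≠ insert v z := fun h => by
      have : u ∈ insert v z := h ▸ mem_insert_self u z
      simp [huv.ne, hu.2] at this
    rw [Fintype.sum_eq_add (insert u z) (insert v z) hne, hbz]
    · exact incSign_insert_insert_add hu.2 hv.2 huv
    · rintro y ⟨hyu, hyv⟩
      by_contra hy
      obtain ⟨hzy, hzc⟩ := face1_of_incSign_ne_zero (left_ne_zero_of_mul hy)
      obtain ⟨hyb, -⟩ := face1_of_incSign_ne_zero (right_ne_zero_of_mul hy)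
      obtain ⟨w, hw⟩ := card_eq_one.1 (show (y \ z).card = 1 by
        rw [card_sdiff_of_subset hzy]; omega)
      have hyw : y = insert w z := by
        rw [← sdiff_union_of_subset hzy, hw]
        rfl
      have hwb : w ∈ b \ z := sdiff_subset_sdiff hyb subset_rfl (by simp [hw])
      rw [hb, mem_insert, mem_singleton] at hwb
      rcases hwb with rfl | rfl
      · exact hyu hyw
      · exact hyv hyw
  · refine sum_eq_zero fun y _ => ?_
    by_contra hy
    obtain ⟨hzy, hzc⟩ := face1_of_incSign_ne_zero (left_ne_zero_of_mul hy)
    obtain ⟨hyb, hyc⟩ := face1_of_incSign_ne_zero (right_ne_zero_of_mul hy)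
    exact h ⟨hzy.trans hyb, by omega⟩

end Incidence

section FlowOrder

/-- The `V`-path step relation restricted to the pairs of `W`. -/
def FlowStep (W : Set (Finset V × Finset V)) (p q : Finset V × Finset V) : Prop :=
  p ∈ W ∧ q ∈ W ∧ VStep p q

variable {W : Set (Finset V × Finset V)}

lemma isVPath_cons {p : Finset V × Finset V} {l : List (Finset V × Finset V)} :
    IsVPath W (p :: l) ↔ p ∈ W ∧ IsVPath W l ∧ ∀ q ∈ l.head?, VStep p q := by
  unfold IsVPath List.Chain'
  rw [List.isChain_cons, List.forall_mem_cons]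
  tauto

lemma IsVPath.isChain_flowStep {l : List (Finset V × Finset V)} (h : IsVPath W l) :
    l.IsChain (FlowStep W) := by
  induction l with
  | nil => exact .nil
  | cons p l ih =>
    obtain ⟨hp, hl, hstep⟩ := isVPath_cons.1 h
    exact List.isChain_cons.2
      ⟨fun q hq => ⟨hp, hl.1 q (List.mem_of_mem_head? hq), hstep q hq⟩, ih hl⟩

lemma isVPath_of_isChain_flowStep {l : List (Finset V × Finset V)} {p : Finset V × Finset V}
    (hp : p ∈ W) (h : (p :: l).IsChain (FlowStep W)) : IsVPath W (p :: l) := by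
  induction l generalizing p with
  | nil => exact isVPath_cons.2 ⟨hp, ⟨by simp, .nil⟩, by simp⟩
  | cons q l ih =>
    obtain ⟨hpq, hl⟩ := List.isChain_cons_cons.1 h
    exact isVPath_cons.2 ⟨hp, ih hpq.2.1 hl, by simpa using hpq.2.2⟩

lemma not_transGen_flowStep_self (hW : ¬ HasClosedVPath W) (p : Finset V × Finset V) :
    ¬ Relation.TransGen (FlowStep W) p p := by
  intro h
  obtain ⟨c, hpc, hcp⟩ := Relation.TransGen.tail'_iff.1 h
  obtain ⟨l, hl, hlast⟩ := List.exists_isChain_cons_of_relationReflTransGen hpc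
  exact hW ⟨p, l, isVPath_of_isChain_flowStep hcp.2.1 hl, hlast ▸ hcp.2.2⟩

lemma IsVPath.nodup (hW : ¬ HasClosedVPath W) {l : List (Finset V × Finset V)}
    (h : IsVPath W l) : l.Nodup := by
  have hl : l.IsChain (Relation.TransGen (FlowStep W)) :=
    h.isChain_flowStep.imp fun _ _ => .single
  refine (List.isChain_iff_pairwise.1 hl).imp ?_
  rintro p _ hpq rfl
  exact not_transGen_flowStep_self hW p hpq

variable [Fintype V]

lemma wellFounded_flowStep (hW : ¬ HasClosedVPath W) : WellFounded (FlowStep W) := by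
  have : Std.Irrefl (Relation.TransGen (FlowStep W)) := ⟨not_transGen_flowStep_self hW⟩
  exact Subrelation.wf Relation.TransGen.single
    (Finite.wellFounded_of_trans_of_irrefl (Relation.TransGen (FlowStep W)))

lemma wellFounded_swap_flowStep (hW : ¬ HasClosedVPath W) :
    WellFounded (Function.swap (FlowStep W)) := by
  have : Std.Irrefl (Function.swap (Relation.TransGen (FlowStep W))) :=
    ⟨not_transGen_flowStep_self hW⟩
  have : IsTrans _ (Function.swap (Relation.TransGen (FlowStep W))) :=
    ⟨fun _ _ _ h h' => Relation.TransGen.trans h' h⟩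
  refine Subrelation.wf (fun {a b} h => ?_)
    (Finite.wellFounded_of_trans_of_irrefl (Function.swap (Relation.TransGen (FlowStep W))))
  exact Relation.TransGen.single h

end FlowOrder

section Flow

/-- The gradient paths of `W` that end at the cell `σ`, starting anywhere. -/
def flowPaths (W : Set (Finset V × Finset V)) (σ : Finset V) :
    Set (List (Finset V × Finset V)) :=
  {l | IsVPath W l ∧ ∀ q ∈ l.getLast?, Face1 σ q.2 ∧ σ ≠ q.1}

variable {W : Set (Finset V × Finset V)} {σ : Finset V}

@[simp]
lemma nextCell_nil : nextCell σ [] = σ := rfl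

@[simp]
lemma nextCell_cons {p : Finset V × Finset V} {l : List (Finset V × Finset V)} :
    nextCell σ (p :: l) = p.1 := rfl

lemma nil_mem_flowPaths : [] ∈ flowPaths W σ := ⟨⟨by simp, .nil⟩, by simp⟩

lemma cons_mem_flowPaths {p : Finset V × Finset V} {l : List (Finset V × Finset V)} :
    p :: l ∈ flowPaths W σ ↔
      p ∈ W ∧ l ∈ flowPaths W σ ∧ Face1 (nextCell σ l) p.2 ∧ nextCell σ l ≠ p.1 := by
  cases l with
  | nil =>
    simp only [flowPaths, Set.mem_ofPred_eq, isVPath_cons (p := p), nextCell_nil, List.head?_nil,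
      List.getLast?_singleton, List.getLast?_nil, Option.mem_def, Option.some.injEq, forall_eq',
      reduceCtorEq, false_imp_iff, implies_true, and_true, and_assoc]
  | cons q l =>
    simp only [flowPaths, Set.mem_ofPred_eq, isVPath_cons (p := p), nextCell_cons, List.head?_cons,
      Option.mem_some_iff, forall_eq', VStep, List.getLast?_cons_cons]
    tauto

lemma gradPaths_eq (τ : Finset V) :
    gradPaths W τ σ = {l | l ∈ flowPaths W σ ∧ Face1 (nextCell σ l) τ} := by
  ext l
  cases l with
  | nil => simp [gradPaths, flowPaths]
  | cons q l =>
    simp only [gradPaths, flowPaths, Set.mem_ofPred_eq, List.head?_cons, Option.mem_some_iff,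
      forall_eq', nextCell_cons, reduceCtorEq, false_imp_iff, true_and]
    tauto

variable [Fintype V]

lemma finite_flowPaths (hW : ¬ HasClosedVPath W) (σ : Finset V) : (flowPaths W σ).Finite :=
  (Set.finite_coe_iff.1
    (inferInstanceAs (Finite {l : List (Finset V × Finset V) // l.Nodup}))).subset
    fun _ hl => hl.1.nodup hW

variable [LinearOrder V]

/-- The signed count of gradient paths from the cell `x` to the cell `σ` of the same dimension. -/
noncomputable def flowCoeff (W : Set (Finset V × Finset V)) (x σ : Finset V) : ℤ :=
  ∑ᶠ l ∈ flowPaths W σ, if nextCell σ l = x then pathSign σ l else 0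

lemma sum_mul_flowCoeff (hW : ¬ HasClosedVPath W) (g : Finset V → ℤ) :
    ∑ y, g y * flowCoeff W y σ = ∑ᶠ l ∈ flowPaths W σ, g (nextCell σ l) * pathSign σ l := by
  simp only [flowCoeff, finsum_mem_eq_finite_toFinset_sum _ (finite_flowPaths hW σ), mul_sum]
  rw [sum_comm]
  simp

lemma morseCoeff_eq_sum (hW : ¬ HasClosedVPath W) (τ σ : Finset V) :
    morseCoeff W τ σ = ∑ y, incSign y τ * flowCoeff W y σ := by
  rw [sum_mul_flowCoeff hW, morseCoeff, gradPaths_eq]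
  refine finsum_mem_inter_support_eq _ _ _ ?_
  ext l
  simp only [Set.mem_inter_iff, Set.mem_ofPred_eq, Function.mem_support]
  exact ⟨fun h => ⟨h.1.1, h.2⟩,
    fun h => ⟨⟨h.1, face1_of_incSign_ne_zero (left_ne_zero_of_mul h.2)⟩, h.2⟩⟩

lemma exists_of_flowCoeff_ne_zero {x : Finset V} (h : flowCoeff W x σ ≠ 0) :
    x = σ ∨ ∃ b, (x, b) ∈ W := by
  obtain ⟨l, hl⟩ := exists_ne_zero_of_finsum_mem_ne_zero h
  obtain ⟨hl, hne⟩ := hl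
  split_ifs at hne with hx
  · cases l with
    | nil => exact Or.inl hx.symm
    | cons q l => exact Or.inr ⟨q.2, by rw [← hx]; exact (cons_mem_flowPaths.1 hl).1⟩
  · exact absurd rfl hne

lemma flowCoeff_self (hσ : ∀ p ∈ W, p.1 ≠ σ) : flowCoeff W σ σ = 1 := by
  rw [flowCoeff, finsum_mem_inter_support_eq _ _ {[]}]
  · simp [pathSign]
  · ext l
    cases l with
    | nil => simp [nil_mem_flowPaths]
    | cons q l =>
      simp only [Set.mem_inter_iff, cons_mem_flowPaths, Function.mem_support, nextCell_cons,
        Set.mem_singleton_iff, reduceCtorEq, false_and, iff_false, not_and]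
      exact fun h => by simp [hσ q h.1]

/-- The flow coefficients vanish on the boundary of the target of every pair. -/
lemma sum_incSign_mul_flowCoeff {a b : Finset V}
    (hW : ¬ HasClosedVPath W) (hfun : ∀ c, (a, c) ∈ W → c = b) (hab : (a, b) ∈ W)
    (hface : Face1 a b) (hσ : σ ≠ a) :
    ∑ y, incSign y b * flowCoeff W y σ = 0 := by
  rw [sum_mul_flowCoeff hW, finsum_mem_eq_finite_toFinset_sum _ (finite_flowPaths hW σ)]
  rw [← sum_filter_of_ne (p := fun l => Face1 (nextCell σ l) b)
    fun l _ h => face1_of_incSign_ne_zero (left_ne_zero_of_mul h)]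
  have hcons : ∀ l ∈ (finite_flowPaths hW σ).toFinset.filter (fun l => Face1 (nextCell σ l) b),
      nextCell σ l = a → ∃ l', l = (a, b) :: l' := by
    intro l hl hla
    cases l with
    | nil => exact absurd hla hσ
    | cons q l =>
      obtain ⟨x, c⟩ := q
      obtain rfl : x = a := hla
      simp only [mem_filter, Set.Finite.mem_toFinset, cons_mem_flowPaths] at hl
      exact ⟨l, by rw [hfun c hl.1.1]⟩
  refine sum_involution (fun l _ => if nextCell σ l = a then l.tail else (a, b) :: l)
    ?_ ?_ ?_ ?_
  · intro l hl
    split_ifs with hla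
    · obtain ⟨l, rfl⟩ := hcons l hl hla
      simp only [nextCell_cons, pathSign, List.tail_cons]
      linear_combination (-incSign (nextCell σ l) b * pathSign σ l) * incSign_mul_self hface
    · simp only [nextCell_cons, pathSign]
      linear_combination (-incSign (nextCell σ l) b * pathSign σ l) * incSign_mul_self hface
  · intro l hl _ heq
    have := congrArg List.length heq
    split_ifs at this with hla
    · obtain ⟨l, rfl⟩ := hcons l hl hla
      simp at this
    · simp at this
  · intro l hl
    split_ifs with hla
    · obtain ⟨l, rfl⟩ := hcons l hl hla
      simp only [mem_filter, Set.Finite.mem_toFinset, cons_mem_flowPaths] at hl ⊢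
      exact ⟨hl.1.2.1, hl.1.2.2.1⟩
    · simp only [mem_filter, Set.Finite.mem_toFinset, cons_mem_flowPaths] at hl ⊢
      exact ⟨⟨hab, hl.1, hl.2, hla⟩, hface⟩
  · intro l hl
    by_cases hla : nextCell σ l = a
    · obtain ⟨l, rfl⟩ := hcons l hl hla
      simp only [mem_filter, Set.Finite.mem_toFinset, cons_mem_flowPaths] at hl
      simp [hl.1.2.2.2]
    · simp [hla]

end Flow

section Gradient

variable {K : Set (Finset V)} {W : Set (Finset V × Finset V)}

lemma IsVFOn.snd_eq (hW : IsVFOn K W) {a b c : Finset V} (hb : (a, b) ∈ W) (hc : (a, c) ∈ W) :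
    c = b := by
  by_contra hne
  exact (hW.2 _ hc _ hb (by simp [hne])).1 rfl

lemma IsVFOn.notMem_of_snd (hW : IsVFOn K W) {a b c : Finset V} (hb : (a, b) ∈ W) :
    (b, c) ∉ W := by
  intro hc
  have hne : (a, b) ≠ (b, c) := by
    intro h
    have hcard := (hW.1 _ hb).2.2.2
    rw [(Prod.mk.inj h).1] at hcard
    exact Nat.succ_ne_self _ hcard
  exact (hW.2 _ hb _ hc hne).2.2.1 rfl

variable [Fintype V]

/-- Induction along the gradient flow: the source of a pair may be treated after all the other
codimension-1 faces of the target. -/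
lemma IsGradientOn.induction (hW : IsGradientOn K W) {P : Finset V → Prop}
    (hbase : ∀ x, (∀ b, (x, b) ∉ W) → P x)
    (hstep : ∀ a b, (a, b) ∈ W → (∀ y, Face1 y b → y ≠ a → P y) → P a) (x : Finset V) : P x := by
  have key : ∀ p ∈ W, P p.1 := fun p => by
    induction p using (wellFounded_swap_flowStep hW.2).induction with
    | _ p ih =>
      intro hp
      refine hstep p.1 p.2 hp fun y hy hne => ?_
      by_cases h : ∃ c, (y, c) ∈ W
      · obtain ⟨c, hc⟩ := h
        exact ih (y, c) ⟨hp, hc, hy, hne⟩ hc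
      · exact hbase y (not_exists.1 h)
  by_cases h : ∃ c, (x, c) ∈ W
  · exact key _ h.choose_spec
  · exact hbase x (not_exists.1 h)

variable [LinearOrder V] {σ : Finset V}

lemma flowCoeff_eq_zero_of_notMem (hW : IsVFOn K W) {x : Finset V} (hx : x ∉ K) (hσ : σ ∈ K) :
    flowCoeff W x σ = 0 := by
  by_contra h
  rcases exists_of_flowCoeff_ne_zero h with rfl | ⟨b, hb⟩
  · exact hx hσ
  · exact hx (hW.1 _ hb).1

lemma flowCoeff_snd (hW : IsVFOn K W) {a b : Finset V} (hab : (a, b) ∈ W)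
    (hσ : σ ∈ critOf W K) : flowCoeff W b σ = 0 := by
  by_contra h
  rcases exists_of_flowCoeff_ne_zero h with rfl | ⟨c, hc⟩
  · exact (hσ.2 _ hab).2 rfl
  · exact hW.notMem_of_snd hab hc

lemma flowCoeff_of_mem_critOf {τ : Finset V} (hτ : τ ∈ critOf W K) :
    flowCoeff W τ σ = if τ = σ then 1 else 0 := by
  split_ifs with h
  · subst h
    exact flowCoeff_self fun p hp => (hτ.2 p hp).1
  · by_contra hne
    rcases exists_of_flowCoeff_ne_zero hne with h' | ⟨c, hc⟩
    · exact h h'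
    · exact (hτ.2 _ hc).1 rfl

lemma morseCoeff_snd (hW : IsGradientOn K W) {a b : Finset V} (hab : (a, b) ∈ W)
    (hσ : σ ∈ critOf W K) : morseCoeff W b σ = 0 := by
  rw [morseCoeff_eq_sum hW.2]
  exact sum_incSign_mul_flowCoeff hW.2 (fun c hc => hW.1.snd_eq hab hc) hab (hW.1.1 _ hab).2.2
    (hσ.2 _ hab).1.symm

lemma sum_incSign_mul_morseCoeff (hW : IsGradientOn K W) (b σ : Finset V) :
    ∑ y, incSign y b * morseCoeff W y σ = 0 := by
  simp only [morseCoeff_eq_sum hW.2, mul_sum]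
  rw [sum_comm]
  refine sum_eq_zero fun z _ => ?_
  rw [← zero_mul (flowCoeff W z σ), ← sum_incSign_mul_incSign z b, sum_mul]
  exact sum_congr rfl fun y _ => by ring

lemma eq_zero_of_sum_eq_zero {a b : Finset V} (hab : Face1 a b) {E : Finset V → ℤ}
    (hsum : ∑ y, incSign y b * E y = 0) (hE : ∀ y, Face1 y b → y ≠ a → E y = 0) : E a = 0 := by
  rw [Fintype.sum_eq_single a] at hsum
  · linear_combination incSign a b * hsum - E a * incSign_mul_self hab
  · intro y hy
    by_cases h : Face1 y b
    · rw [hE y h hy, mul_zero]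
    · rw [incSign_of_not_face1 h, zero_mul]

lemma morseCoeff_eq_sum_flowCoeff (hK : K.OrdConnected) (hW : IsGradientOn K W)
    (hσ : σ ∈ critOf W K) (n : ℕ) {x c : Finset V} (hc : c ∈ K) (hxc : x ⊆ c) (hx : x.card = n) :
    morseCoeff W x σ = ∑ τ : cellsD (critOf W K) n, morseCoeff W τ.1 σ * flowCoeff W x τ.1 := by
  induction x using hW.induction generalizing c with
  | hbase x hsrc =>
    by_cases hxK : x ∈ K
    · by_cases hcrit : x ∈ critOf W K
      · refine Eq.trans ?_
          (Fintype.sum_eq_single (⟨x, hcrit, hx⟩ : cellsD (critOf W K) n) ?_).symm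
        · simp [flowCoeff_of_mem_critOf hcrit]
        · intro τ hτ
          rw [flowCoeff_of_mem_critOf hcrit, if_neg fun h => hτ (Subtype.ext h.symm), mul_zero]
      · obtain ⟨a, ha⟩ : ∃ a, (a, x) ∈ W := by
          by_contra hne
          refine hcrit ⟨hxK, fun p hp => ⟨?_, ?_⟩⟩
          · rintro rfl
            exact hsrc _ hp
          · rintro rfl
            exact hne ⟨_, hp⟩
        rw [morseCoeff_snd hW ha hσ]
        exact (sum_eq_zero fun τ _ => by rw [flowCoeff_snd hW.1 ha τ.2.1, mul_zero]).symm
    · rw [morseCoeff_eq_sum hW.2]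
      trans 0
      · refine sum_eq_zero fun y _ => ?_
        by_contra hne
        have hyK : y ∈ K := by
          by_contra hyK
          exact right_ne_zero_of_mul hne (flowCoeff_eq_zero_of_notMem hW.1 hyK hσ.1)
        exact hxK (hK.out hyK hc ⟨(face1_of_incSign_ne_zero (left_ne_zero_of_mul hne)).1, hxc⟩)
      · exact (sum_eq_zero fun τ _ => by
          rw [flowCoeff_eq_zero_of_notMem hW.1 hxK τ.2.1.1, mul_zero]).symm
  | hstep a b hab ih =>
    have hface : Face1 a b := (hW.1.1 _ hab).2.2
    rw [← sub_eq_zero]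
    refine eq_zero_of_sum_eq_zero (E := fun x => morseCoeff W x σ -
      ∑ τ : cellsD (critOf W K) n, morseCoeff W τ.1 σ * flowCoeff W x τ.1) hface ?_ ?_
    · simp only [mul_sub, sum_sub_distrib, sum_incSign_mul_morseCoeff hW, zero_sub, neg_eq_zero,
        mul_sum]
      rw [sum_comm]
      refine sum_eq_zero fun τ _ => ?_
      obtain ⟨t, ht, -⟩ := τ
      have hb := morseCoeff_snd hW hab ht
      rw [morseCoeff_eq_sum hW.2] at hb
      rw [← mul_zero (morseCoeff W t σ), ← hb, mul_sum]
      exact sum_congr rfl fun y _ => by ring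
    · intro y hy hne
      rw [sub_eq_zero]
      exact ih y hy hne (hW.1.1 _ hab).2.1 hy.1 (by have := hy.2; have := hface.2; omega)

end Gradient

section ChainMaps

variable [Fintype V]

lemma sum_cellsD {S : Set (Finset V)} {n : ℕ} {f : Finset V → ℤ}
    (hf : ∀ y, f y ≠ 0 → y ∈ S ∧ y.card = n) : ∑ y : cellsD S n, f y.1 = ∑ y, f y := by
  refine Fintype.sum_of_injective (fun y : cellsD S n => y.1) Subtype.val_injective _ _
    (fun y hy => ?_) fun _ => rfl
  by_contra hne
  exact hy ⟨⟨y, hf y hne⟩, rfl⟩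

variable [LinearOrder V] {K : Set (Finset V)} {W : Set (Finset V × Finset V)}

/-- The map from simplicial chains to Morse chains that flows every cell down to critical cells. -/
noncomputable def flowMap (W : Set (Finset V × Finset V)) (K : Set (Finset V)) (n : ℕ) :
    (cellsD K n → ℤ) →ₗ[ℤ] (cellsD (critOf W K) n → ℤ) :=
  Matrix.mulVecLin (Matrix.of fun (σ : cellsD (critOf W K) n) (x : cellsD K n) =>
    flowCoeff W x.1 σ.1)

/-- Extension by zero of chains on critical cells. -/
noncomputable def critInclusion (W : Set (Finset V × Finset V)) (K : Set (Finset V)) (n : ℕ) :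
    (cellsD (critOf W K) n → ℤ) →ₗ[ℤ] (cellsD K n → ℤ) :=
  Matrix.mulVecLin (Matrix.of fun (x : cellsD K n) (σ : cellsD (critOf W K) n) =>
    if x.1 = σ.1 then (1 : ℤ) else 0)

lemma critInclusion_single {n : ℕ} (x : cellsD K n) (hx : x.1 ∈ critOf W K) :
    critInclusion W K n (Pi.single ⟨x.1, hx, x.2.2⟩ 1) = Pi.single x 1 := by
  ext y
  refine (congrFun (Matrix.mulVec_single_one _ _) y).trans ?_
  rw [Pi.single_apply]
  exact if_congr Subtype.ext_iff.symm rfl rfl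

lemma flowMap_critInclusion {n : ℕ} (m : cellsD (critOf W K) n → ℤ) :
    flowMap W K n (critInclusion W K n m) = m := by
  suffices h : flowMap W K n ∘ₗ critInclusion W K n = LinearMap.id from LinearMap.congr_fun h m
  rw [flowMap, critInclusion, ← Matrix.mulVecLin_mul, ← Matrix.mulVecLin_one]
  congr 1
  ext σ τ
  refine (Fintype.sum_eq_single (⟨τ.1, τ.2.1.1, τ.2.2⟩ : cellsD K n) ?_).trans ?_
  · intro x hx
    change flowCoeff W x.1 σ.1 * (if x.1 = τ.1 then 1 else 0) = 0
    rw [if_neg fun h => hx (Subtype.ext h), mul_zero]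
  · change flowCoeff W τ.1 σ.1 * (if τ.1 = τ.1 then 1 else 0) = _
    rw [if_pos rfl, mul_one, flowCoeff_of_mem_critOf τ.2.1, Matrix.one_apply]
    exact if_congr ⟨fun h => Subtype.ext h.symm, fun h => h ▸ rfl⟩ rfl rfl

lemma flowMap_surjective (n : ℕ) : Function.Surjective (flowMap W K n) :=
  fun m => ⟨_, flowMap_critInclusion m⟩

lemma flowMap_simpBd (hK : K.OrdConnected) (hW : IsGradientOn K W) {n : ℕ}
    (c : cellsD K (n + 1) → ℤ) :
    flowMap W K n (simpBd K n c) = morseBd W (critOf W K) n (flowMap W K (n + 1) c) := by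
  suffices h : flowMap W K n ∘ₗ simpBd K n = morseBd W (critOf W K) n ∘ₗ flowMap W K (n + 1) from
    LinearMap.congr_fun h c
  rw [flowMap, flowMap, simpBd, morseBd, ← Matrix.mulVecLin_mul, ← Matrix.mulVecLin_mul]
  congr 1
  ext σ x
  simp only [Matrix.mul_apply, Matrix.of_apply]
  rw [← morseCoeff_eq_sum_flowCoeff hK hW σ.2.1 (n + 1) x.2.1 subset_rfl x.2.2,
    morseCoeff_eq_sum hW.2, sum_cellsD (f := fun y => flowCoeff W y σ.1 * incSign y x.1)]
  · exact sum_congr rfl fun y _ => mul_comm _ _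
  · intro y hy
    refine ⟨?_, ?_⟩
    · by_contra hyK
      exact left_ne_zero_of_mul hy (flowCoeff_eq_zero_of_notMem hW.1 hyK σ.2.1.1)
    · have := (face1_of_incSign_ne_zero (right_ne_zero_of_mul hy)).2
      have := x.2.2
      omega

/-- The boundary of a boundary vanishes, also as seen from cells of an arbitrary dimension. -/
lemma sum_incSign_mul_simpBd (hK : K.OrdConnected) {z : Finset V} (hz : z ∈ K) {n : ℕ}
    (c : cellsD K (n + 1) → ℤ) : ∑ y : cellsD K n, incSign z y.1 * simpBd K n c y = 0 := by
  simp only [simpBd, Matrix.mulVecLin_apply, Matrix.mulVec, dotProduct, Matrix.of_apply, mul_sum]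
  rw [sum_comm]
  refine sum_eq_zero fun x _ => ?_
  simp only [← mul_assoc]
  rw [← sum_mul, sum_cellsD (f := fun y => incSign z y * incSign y x.1), sum_incSign_mul_incSign,
    zero_mul]
  intro y hy
  have hzy := face1_of_incSign_ne_zero (left_ne_zero_of_mul hy)
  have hyx := face1_of_incSign_ne_zero (right_ne_zero_of_mul hy)
  refine ⟨hK.out hz x.2.1 ⟨hzy.1, hyx.1⟩, ?_⟩
  have := hyx.2
  have := x.2.2
  omega

lemma simpBd_simpBd (hK : K.OrdConnected) {n : ℕ} (c : cellsD K (n + 1 + 1) → ℤ) :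
    simpBd K n (simpBd K (n + 1) c) = 0 :=
  funext fun z => sum_incSign_mul_simpBd hK z.2.1 c

lemma sum_incSign_mul_of_simpBd_eq_zero {n : ℕ} {k : cellsD K (n + 1) → ℤ}
    (hk : simpBd K n k = 0) {z : Finset V} (hz : z ∈ K) : ∑ y, incSign z y.1 * k y = 0 := by
  by_cases h : z.card = n
  · exact congrFun hk ⟨z, hz, h⟩
  · refine sum_eq_zero fun y _ => ?_
    rw [incSign_of_not_face1, zero_mul]
    intro hf
    have := hf.2
    have := y.2.2
    omega

/-- The chains supported on the targets of the pairs of `W`. -/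
def targetChains (W : Set (Finset V × Finset V)) (K : Set (Finset V)) (n : ℕ) :
    Submodule ℤ (cellsD K n → ℤ) where
  carrier := {f | ∀ x : cellsD K n, (∀ a, (a, x.1) ∉ W) → f x = 0}
  add_mem' hf hg x hx := by simp [hf x hx, hg x hx]
  zero_mem' _ _ := rfl
  smul_mem' r f hf x hx := by simp [hf x hx]

lemma single_mem_targetChains {n : ℕ} (x : cellsD K n) {a : Finset V} (ha : (a, x.1) ∈ W) :
    Pi.single x 1 ∈ targetChains W K n := by
  intro y hy
  rw [Pi.single_apply, if_neg]
  rintro rfl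
  exact hy a ha

lemma flowMap_of_mem_targetChains (hW : IsVFOn K W) {n : ℕ} {f : cellsD K n → ℤ}
    (hf : f ∈ targetChains W K n) : flowMap W K n f = 0 := by
  ext σ
  refine sum_eq_zero fun x _ => ?_
  by_cases h : ∃ a, (a, x.1) ∈ W
  · obtain ⟨a, ha⟩ := h
    simp [flowCoeff_snd hW ha σ.2.1]
  · simp [hf x (not_exists.1 h)]

lemma eq_zero_of_mem_targetChains (hW : IsGradientOn K W) {n : ℕ} {f : cellsD K n → ℤ}
    (hf : f ∈ targetChains W K n) (hcyc : ∀ z ∈ K, ∑ y, incSign z y.1 * f y = 0) : f = 0 := by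
  have key : ∀ p ∈ W, ∀ x : cellsD K n, x.1 = p.2 → f x = 0 := fun p => by
    induction p using (wellFounded_flowStep hW.2).induction with
    | _ p ih =>
      intro hp x hx
      have hface : Face1 p.1 x.1 := hx ▸ (hW.1.1 p hp).2.2
      have hsum := hcyc p.1 (hW.1.1 p hp).1
      have hsingle : ∑ y, incSign p.1 y.1 * f y = incSign p.1 x.1 * f x := by
        refine Fintype.sum_eq_single x fun y hy => ?_
        by_contra hne
        have hpy := face1_of_incSign_ne_zero (left_ne_zero_of_mul hne)
        obtain ⟨a, ha⟩ : ∃ a, (a, y.1) ∈ W := by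
          by_contra hna
          exact right_ne_zero_of_mul hne (hf y (not_exists.1 hna))
        refine right_ne_zero_of_mul hne (ih (a, y.1) ⟨ha, hp, hpy, ?_⟩ ha y rfl)
        rintro rfl
        exact hy (Subtype.ext ((hW.1.snd_eq hp ha).trans hx.symm))
      rw [hsingle] at hsum
      linear_combination incSign p.1 x.1 * hsum - f x * incSign_mul_self hface
  ext x
  by_cases h : ∃ a, (a, x.1) ∈ W
  · obtain ⟨a, ha⟩ := h
    exact key _ ha x rfl
  · exact hf x (not_exists.1 h)

lemma simpBd_single {n : ℕ} (b : cellsD K (n + 1)) :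
    simpBd K n (Pi.single b 1) = ∑ y : cellsD K n, incSign y.1 b.1 • Pi.single y (1 : ℤ) := by
  ext z
  refine (congrFun (Matrix.mulVec_single_one _ _) z).trans ?_
  simp [Finset.sum_apply, Pi.single_apply]

lemma sub_critInclusion_flowMap_mem (hK : K.OrdConnected) (hW : IsGradientOn K W) {n : ℕ}
    (k : cellsD K n → ℤ) :
    k - critInclusion W K n (flowMap W K n k) ∈
      targetChains W K n ⊔ (targetChains W K (n + 1)).map (simpBd K n) := by
  set N := targetChains W K n ⊔ (targetChains W K (n + 1)).map (simpBd K n)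
  set g : (cellsD K n → ℤ) →ₗ[ℤ] (cellsD K n → ℤ) :=
    LinearMap.id - critInclusion W K n ∘ₗ flowMap W K n with hg
  change g k ∈ N
  have hker : ∀ f, flowMap W K n f = 0 → g f = f := fun f hf => by simp [hg, hf]
  have key : ∀ x : Finset V, ∀ hx : x ∈ K ∧ x.card = n,
      g (Pi.single (⟨x, hx⟩ : cellsD K n) 1) ∈ N := by
    refine hW.induction (fun x hsrc hx => ?_) (fun a b hab ih hx => ?_)
    · by_cases hcrit : x ∈ critOf W K
      · rw [← critInclusion_single (W := W) ⟨x, hx⟩ hcrit]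
        simp [hg, flowMap_critInclusion]
      · obtain ⟨a, ha⟩ : ∃ a, (a, x) ∈ W := by
          by_contra hne
          refine hcrit ⟨hx.1, fun p hp => ⟨?_, ?_⟩⟩
          · rintro rfl
            exact hsrc _ hp
          · rintro rfl
            exact hne ⟨_, hp⟩
        have hmem := single_mem_targetChains (W := W) (⟨x, hx⟩ : cellsD K n) ha
        rw [hker _ (flowMap_of_mem_targetChains hW.1 hmem)]
        exact Submodule.mem_sup_left hmem
    · obtain ⟨-, hbK, hface⟩ := hW.1.1 _ hab
      let b' : cellsD K (n + 1) := ⟨b, hbK, by have := hface.2; have := hx.2; simp_all⟩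
      have hmem := single_mem_targetChains (W := W) b' hab
      have hbd : g (simpBd K n (Pi.single b' 1)) ∈ N := by
        rw [hker _ (by rw [flowMap_simpBd hK hW, flowMap_of_mem_targetChains hW.1 hmem, map_zero])]
        exact Submodule.mem_sup_right (Submodule.mem_map_of_mem hmem)
      have hsplit := add_sum_erase univ
        (fun y : cellsD K n => g (incSign y.1 b • Pi.single y (1 : ℤ)))
        (mem_univ (⟨a, hx⟩ : cellsD K n))
      rw [simpBd_single, map_sum, ← hsplit, N.add_mem_iff_left] at hbd
      · have := N.smul_mem (incSign a b) hbd
        rwa [map_smul, smul_smul, incSign_mul_self hface, one_smul] at this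
      · refine N.sum_mem fun y hy => ?_
        rw [map_smul]
        by_cases hyb : Face1 y.1 b
        · exact N.smul_mem _ (ih y.1 hyb (fun h => ne_of_mem_erase hy (Subtype.ext h)) y.2)
        · rw [incSign_of_not_face1 hyb, zero_smul]
          exact N.zero_mem
  rw [← Finset.univ_sum_single k, map_sum]
  refine N.sum_mem fun x _ => ?_
  have : (Pi.single x (k x) : cellsD K n → ℤ) = k x • Pi.single x 1 := by
    rw [← Pi.single_smul]
    simp
  rw [this, map_smul]
  exact N.smul_mem _ (key x.1 x.2)

/-- The kernel of the flow map is acyclic. -/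
lemma exists_simpBd_eq_of_flowMap_eq_zero (hK : K.OrdConnected) (hW : IsGradientOn K W) {n : ℕ}
    {k : cellsD K n → ℤ} (hk : flowMap W K n k = 0)
    (hcyc : ∀ z ∈ K, ∑ y, incSign z y.1 * k y = 0) :
    ∃ c, flowMap W K (n + 1) c = 0 ∧ simpBd K n c = k := by
  have hmem := sub_critInclusion_flowMap_mem hK hW k
  rw [hk, map_zero, sub_zero] at hmem
  obtain ⟨f, hf, _, ⟨c, hc, rfl⟩, rfl⟩ := Submodule.mem_sup.1 hmem
  have hf0 : f = 0 := by
    refine eq_zero_of_mem_targetChains hW hf fun z hz => ?_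
    simpa [mul_add, sum_add_distrib, sum_incSign_mul_simpBd hK hz] using hcyc z hz
  exact ⟨c, flowMap_of_mem_targetChains hW.1 hc, by rw [hf0, zero_add]⟩

end ChainMaps

section Homology

variable {R A B C A' B' C' : Type*} [Ring R] [AddCommGroup A] [AddCommGroup B] [AddCommGroup C]
  [AddCommGroup A'] [AddCommGroup B'] [AddCommGroup C'] [Module R A] [Module R B] [Module R C]
  [Module R A'] [Module R B'] [Module R C']

/-- A surjective chain map whose kernel is acyclic is an isomorphism in homology. -/
theorem nonempty_hgy_equiv_of_acyclic_ker {d₁ : B →ₗ[R] A} {d₂ : C →ₗ[R] B} {e₁ : B' →ₗ[R] A'}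
    {e₂ : C' →ₗ[R] B'} (hd : ∀ c, d₁ (d₂ c) = 0)
    {f₀ : A →ₗ[R] A'} {f₁ : B →ₗ[R] B'} {f₂ : C →ₗ[R] C'}
    (h₁ : ∀ b, f₀ (d₁ b) = e₁ (f₁ b)) (h₂ : ∀ c, f₁ (d₂ c) = e₂ (f₂ c))
    (hf₁ : Function.Surjective f₁) (hf₂ : Function.Surjective f₂)
    (hker₀ : ∀ b, f₀ (d₁ b) = 0 → ∃ b', f₁ b' = 0 ∧ d₁ b' = d₁ b)
    (hker₁ : ∀ b, f₁ b = 0 → d₁ b = 0 → ∃ c, d₂ c = b) :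
    Nonempty (Hgy e₁ e₂ ≃ₗ[R] Hgy d₁ d₂) := by
  have hmaps : ∀ b ∈ LinearMap.ker d₁, f₁ b ∈ LinearMap.ker e₁ := fun b hb => by
    rw [LinearMap.mem_ker, ← h₁, LinearMap.mem_ker.1 hb, map_zero]
  let φ : LinearMap.ker d₁ →ₗ[R] Hgy e₁ e₂ := Submodule.mkQ _ ∘ₗ f₁.restrict hmaps
  have hφ : Function.Surjective φ := by
    refine (Submodule.mkQ_surjective _).comp ?_
    rintro ⟨m, hm⟩
    obtain ⟨b, rfl⟩ := hf₁ m
    obtain ⟨b', hb', hdb⟩ := hker₀ b (by rw [h₁]; exact hm)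
    refine ⟨⟨b - b', by simp [hdb]⟩, Subtype.ext ?_⟩
    simp [hb']
  have hkerφ : LinearMap.ker φ =
      Submodule.comap (LinearMap.ker d₁).subtype (LinearMap.range d₂) := by
    ext ⟨b, hb⟩
    simp only [φ, LinearMap.mem_ker, LinearMap.comp_apply, Submodule.mkQ_apply,
      Submodule.Quotient.mk_eq_zero, Submodule.mem_comap, Submodule.subtype_apply,
      LinearMap.mem_range, LinearMap.coe_restrict_apply]
    constructor
    · rintro ⟨m, hm⟩
      obtain ⟨c, rfl⟩ := hf₂ m
      obtain ⟨c', hc'⟩ := hker₁ (b - d₂ c) (by rw [map_sub, h₂, hm, sub_self])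
        (by rw [map_sub, hd, LinearMap.mem_ker.1 hb, sub_zero])
      exact ⟨c' + c, by rw [map_add, hc', sub_add_cancel]⟩
    · rintro ⟨c, rfl⟩
      exact ⟨f₂ c, (h₂ c).symm⟩
  exact ⟨((Submodule.quotEquivOfEq _ _ hkerφ).symm.trans (φ.quotKerEquivOfSurjective hφ)).symm⟩

end Homology

/-- For a gradient on an order-connected collection of simplices, Morse homology is simplicial
homology. -/
theorem nonempty_morseHomology_equiv [LinearOrder V] [Fintype V] {K : Set (Finset V)}
    {W : Set (Finset V × Finset V)} (hK : K.OrdConnected) (hW : IsGradientOn K W) (i : ℕ) :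
    Nonempty (MorseHomology W (critOf W K) i ≃ₗ[ℤ] BMHomology K i) := by
  refine nonempty_hgy_equiv_of_acyclic_ker (simpBd_simpBd hK) (flowMap_simpBd hK hW)
    (flowMap_simpBd hK hW) (flowMap_surjective _) (flowMap_surjective _) ?_ ?_
  · exact fun b hb => exists_simpBd_eq_of_flowMap_eq_zero hK hW hb
      fun z hz => sum_incSign_mul_simpBd hK hz b
  · intro b hb hdb
    obtain ⟨c, -, hc⟩ := exists_simpBd_eq_of_flowMap_eq_zero hK hW hb
      fun z hz => sum_incSign_mul_of_simpBd_eq_zero hdb hz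
    exact ⟨c, hc⟩

lemma ordConnected_Kset (X T : SComplex V) : (Kset X T).OrdConnected := by
  refine ⟨fun z hz b hb y hy => ?_⟩
  have hne : z.Nonempty := X.nonempty_of_mem z hz.1
  exact ⟨X.down_closed b hb.1 y hy.2 (hne.mono hy.1),
    fun hyT => hz.2 (T.down_closed y hyT z hy.1 hne)⟩

/-- The homology of the Morse complex of a gradient on the open simplicial
complex `K = X \ T` is isomorphic to the relative simplicial homology `H_i(X, T)`, i.e.
to the Borel–Moore homology `H_i^{BM}(K)`. -/
theorem stmt_10 {V : Type u} [DecidableEq V] [LinearOrder V] [Fintype V]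
    (X T : SComplex V) (hT : T.faces ⊆ X.faces)
    (W : Set (Finset V × Finset V)) (hW : IsGradientOn (Kset X T) W) (i : ℕ) :
    Nonempty (MorseHomology W (critOf W (Kset X T)) i ≃ₗ[ℤ] BMHomology (Kset X T) i) := by
  exact nonempty_morseHomology_equiv (ordConnected_Kset X T) hW i
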